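/- (Proposition 1, local optimality at a fixed point.) Let X ∈ {0,1}^{m×n} and let (u,v) ∈ {0,1}^m × {0,1}^n be a fixed point of the Proximus update map, i.e., u_i = 1((X_{i:})·v > h(v)/2) for all i and v_j = 1((X_{:j})·u > h(u)/2) for all j. Then (u,v) is a local minimum of h(X ⊕ uv^T) in a Hamming ball of radius 1: for every (u',v') obtained from (u,v) by changing at most one coordinate of u or at most one coordinate of v, h(X ⊕ u'(v')^T) ≥ h(X ⊕ uv^T). -/

import Mathlib

open Finset

/-- Hamming weight of a binary vector. -/
def hW {m : ℕ} (x : Fin m → Bool) : ℕ :=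
  (univ.filter fun i => x i = true).card

/-- Hamming weight of a binary matrix. -/
def hM {m n : ℕ} (X : Fin m → Fin n → Bool) : ℕ :=
  (univ.filter fun p : Fin m × Fin n => X p.1 p.2 = true).card

/-- Integer inner product of two binary vectors. -/
def dotB {m : ℕ} (x y : Fin m → Bool) : ℕ :=
  (univ.filter fun i => (x i && y i) = true).card

/-- Cost h(X ⊕ u vᵀ) of the rank-one XOR approximation. -/
def cost {m n : ℕ} (X : Fin m → Fin n → Bool) (u : Fin m → Bool) (v : Fin n → Bool) : ℕ :=
  hM (fun i j => xor (X i j) (u i && v j))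

/-- Counting identity `h(x ⊕ y) + 2 x·y = h(x) + h(y)`. -/
lemma hW_xor_add_two_mul_dotB {n : ℕ} (x y : Fin n → Bool) :
    hW (fun j => xor (x j) (y j)) + 2 * dotB x y = hW x + hW y := by
  simp only [hW, dotB, card_filter, mul_sum, ← sum_add_distrib]
  refine sum_congr rfl fun j _ => ?_
  cases x j <;> cases y j <;> rfl

lemma cost_eq_sum_rows {m n : ℕ} (X : Fin m → Fin n → Bool) (u : Fin m → Bool)
    (v : Fin n → Bool) :
    cost X u v = ∑ i, hW (fun j => xor (X i j) (u i && v j)) := by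
  simp only [cost, hM, hW, card_filter, Fintype.sum_prod_type]

lemma cost_transpose {m n : ℕ} (X : Fin m → Fin n → Bool) (u : Fin m → Bool)
    (v : Fin n → Bool) :
    cost (fun j i => X i j) v u = cost X u v := by
  simp only [cost, hM, card_filter, Fintype.sum_prod_type]
  rw [sum_comm]
  simp only [Bool.and_comm]

/-- The row update of the Proximus map minimizes the cost over all choices of `u`. -/
lemma cost_le_of_row_update {m n : ℕ} (X : Fin m → Fin n → Bool) (u : Fin m → Bool)
    (v : Fin n → Bool)
    (hu : ∀ i, u i = decide ((dotB (X i) v : ℚ) > (hW v : ℚ) / 2)) (u' : Fin m → Bool) :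
    cost X u v ≤ cost X u' v := by
  rw [cost_eq_sum_rows, cost_eq_sum_rows]
  refine sum_le_sum fun i _ => ?_
  have heta : hW (fun j => X i j) = hW (X i) := rfl
  have hxor := hW_xor_add_two_mul_dotB (X i) v
  have hiff : u i = true ↔ hW v < 2 * dotB (X i) v := by
    rw [hu i, decide_eq_true_iff, gt_iff_lt, div_lt_iff₀' two_pos]
    exact_mod_cast Iff.rfl
  cases h : u i <;> cases u' i <;>
    simp only [h, Bool.false_eq_true, false_iff, true_iff, not_lt] at hiff <;>
    simp only [Bool.false_and, Bool.true_and, Bool.xor_false, heta] <;> omega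

/-- Proposition 1: a fixed point (u,v) of the Proximus update map is a
local minimum of h(X ⊕ u vᵀ) in a Hamming ball of radius 1: any (u',v') obtained by
changing at most one coordinate of u, or at most one coordinate of v, does not
decrease the cost. -/
theorem proximus_fixed_point_local_min {m n : ℕ}
    (X : Fin m → Fin n → Bool) (u : Fin m → Bool) (v : Fin n → Bool)
    (hu : ∀ i, u i = decide ((dotB (X i) v : ℚ) > (hW v : ℚ) / 2))
    (hv : ∀ j, v j = decide ((dotB (fun i => X i j) u : ℚ) > (hW u : ℚ) / 2)) :
    ∀ (u' : Fin m → Bool) (v' : Fin n → Bool),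
      ((v' = v ∧ (univ.filter fun i => u' i ≠ u i).card ≤ 1) ∨
       (u' = u ∧ (univ.filter fun j => v' j ≠ v j).card ≤ 1)) →
      cost X u v ≤ cost X u' v' := by
  rintro u' v' (⟨rfl, -⟩ | ⟨rfl, -⟩)
  · exact cost_le_of_row_update X u v' hu u'
  · rw [← cost_transpose X u' v, ← cost_transpose X u' v']
    exact cost_le_of_row_update (fun j i => X i j) v u' hv v'
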